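/- Assume q > 5, r ≥ q, and conditions (B), (D) and (F1); assume every nonzero L_0-submodule V of L_{−2} satisfies [V, L_1] = L_{−1}; assume [L_{−q+1}, L_q] = L_1; assume that for every i > 0 and every nonzero x ∈ L_i one has [x, L_{−q}] ≠ 0; assume L_{−q+1} and L_{−q+2} are irreducible L_0-modules; and assume [L_{−q+2}, L_{q−3}] = L_{−1}, [L_{−1}, L_{−q+1}] = L_{−q}, and [L_{−q}, L_{q−1}] = L_{−1}. Then L_{−2} is an irreducible L_0-module. (Lemma 2.22.) -/

import Mathlib

/- Graded Lie algebra setting: `F` a field of characteristic 3, `A` a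
finite-dimensional Lie algebra over `F`, with a `ℤ`-grading `L : ℤ → Submodule F A`. -/

namespace GradedLie

variable {F A : Type*} [Field F] [CharP F 3] [LieRing A] [LieAlgebra F A]

/-- The linear span of all brackets `⁅u, v⁆` with `u ∈ U`, `v ∈ V`. -/
def bSpan (U V : Submodule F A) : Submodule F A :=
  Submodule.span F {z | ∃ u ∈ U, ∃ v ∈ V, z = ⁅u, v⁆}

/-- `M` is an irreducible `L0`-module under the adjoint action:
`M ≠ 0` and the only `L0`-submodules of `M` are `0` and `M`. -/
def IsIrred (L0 M : Submodule F A) : Prop :=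
  M ≠ ⊥ ∧ ∀ V ≤ M, bSpan L0 V ≤ V → V = ⊥ ∨ V = M

theorem bSpan_le {U V W : Submodule F A} (h : ∀ u ∈ U, ∀ v ∈ V, ⁅u, v⁆ ∈ W) :
    bSpan U V ≤ W := by
  unfold bSpan
  rw [Submodule.span_le]
  rintro z ⟨u, hu, v, hv, rfl⟩
  exact h u hu v hv

theorem mem_bSpan {U V : Submodule F A} {u v : A} (hu : u ∈ U) (hv : v ∈ V) :
    ⁅u, v⁆ ∈ bSpan U V :=
  Submodule.subset_span ⟨u, hu, v, hv, rfl⟩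

theorem bSpan_mono {U V U' V' : Submodule F A} (h : U ≤ U') (h' : V ≤ V') :
    bSpan U V ≤ bSpan U' V' :=
  bSpan_le fun _ hu _ hv => mem_bSpan (h hu) (h' hv)

theorem bSpan_comm_le (U V : Submodule F A) : bSpan U V ≤ bSpan V U :=
  bSpan_le fun u hu v hv => by
    rw [← lie_skew]
    exact Submodule.neg_mem _ (mem_bSpan hv hu)

theorem bSpan_comm (U V : Submodule F A) : bSpan U V = bSpan V U :=
  le_antisymm (bSpan_comm_le U V) (bSpan_comm_le V U)

theorem bSpan_bot (U : Submodule F A) : bSpan U ⊥ = ⊥ := by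
  rw [eq_bot_iff]
  refine bSpan_le fun u _ v hv => ?_
  rw [Submodule.mem_bot] at hv
  subst hv
  simp

/-- The Jacobi identity for spans, in the form of an upper bound. -/
theorem bSpan_jacobi {U V W M : Submodule F A} (h1 : bSpan U (bSpan V W) ≤ M)
    (h2 : bSpan V (bSpan U W) ≤ M) : bSpan (bSpan U V) W ≤ M := by
  refine bSpan_le fun x hx w hw => ?_
  induction hx using Submodule.span_induction with
  | mem x hx =>
    obtain ⟨u, hu, v, hv, rfl⟩ := hx
    rw [lie_lie]
    exact Submodule.sub_mem _ (h1 (mem_bSpan hu (mem_bSpan hv hw)))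
      (h2 (mem_bSpan hv (mem_bSpan hu hw)))
  | zero => simp
  | add x y _ _ hx hy => rw [add_lie]; exact Submodule.add_mem _ hx hy
  | smul a x _ hx => rw [smul_lie]; exact Submodule.smul_mem _ _ hx

/-- The powers `V`, `[V, V]`, `[V, [V, V]]`, ... -/
def vpow (V : Submodule F A) : ℕ → Submodule F A
  | 0 => V
  | k + 1 => bSpan V (vpow V k)

/-- Lemma 2.22: under the stated hypotheses with `q > 5` and `r ≥ q`,
`L (-2)` is an irreducible `L 0`-module. -/
theorem lemma_2_22
    [FiniteDimensional F A]
    (L : ℤ → Submodule F A)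
    (hdecomp : DirectSum.IsInternal L)
    (hgrade : ∀ i j : ℤ, ∀ x ∈ L i, ∀ y ∈ L j, ⁅x, y⁆ ∈ L (i + j))
    (q r : ℤ) (hq : 1 ≤ q) (hr : 1 ≤ r)
    (hbound : ∀ i : ℤ, i < -q ∨ r < i → L i = ⊥)
    (hbot : L (-q) ≠ ⊥)
    (hq5 : 5 < q) (hrq : q ≤ r)
    (hB : IsIrred (L 0) (L (-1)))
    (hD : ∀ i : ℤ, 1 < i → L (-i) = bSpan (L (-i + 1)) (L (-1)))
    (hF1 : ∀ i : ℤ, -q < i → ∀ x ∈ L i, x ≠ 0 → ∃ y ∈ L (-1), ⁅y, x⁆ ≠ 0)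
    (hV : ∀ V : Submodule F A, V ≤ L (-2) → V ≠ ⊥ → bSpan (L 0) V ≤ V →
      bSpan V (L 1) = L (-1))
    (hq1 : bSpan (L (-q + 1)) (L q) = L 1)
    (hann : ∀ i : ℤ, 0 < i → ∀ x ∈ L i, x ≠ 0 → ∃ y ∈ L (-q), ⁅x, y⁆ ≠ 0)
    (hi1 : IsIrred (L 0) (L (-q + 1)))
    (hi2 : IsIrred (L 0) (L (-q + 2)))
    (h3 : bSpan (L (-q + 2)) (L (q - 3)) = L (-1))
    (h4 : bSpan (L (-1)) (L (-q + 1)) = L (-q))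
    (h5 : bSpan (L (-q)) (L (q - 1)) = L (-1)) :
    IsIrred (L 0) (L (-2)) := by
  have gr : ∀ {i j k : ℤ} {P Q : Submodule F A}, P ≤ L i → Q ≤ L j → i + j = k →
      bSpan P Q ≤ L k := by
    intro i j k P Q hP hQ hk
    subst hk
    exact bSpan_le fun u hu v hv => hgrade i j u (hP hu) v (hQ hv)
  have grbot : ∀ {i j : ℤ} {P Q : Submodule F A}, P ≤ L i → Q ≤ L j → i + j < -q →
      bSpan P Q = ⊥ := by
    intro i j P Q hP hQ hk
    have := gr hP hQ rfl
    rw [hbound _ (Or.inl hk)] at this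
    exact eq_bot_iff.2 this
  refine ⟨?_, ?_⟩
  · intro h
    obtain ⟨x, hx, hx0⟩ := Submodule.exists_mem_ne_zero_of_ne_bot hB.1
    obtain ⟨y, hy, hyx⟩ := hF1 (-1) (by omega) x hx hx0
    have := hgrade _ _ y hy x hx
    rw [show (-1 : ℤ) + -1 = -2 by norm_num, h] at this
    exact hyx (by simpa using this)
  intro V hVle hVs
  by_cases hV0 : V = ⊥
  · exact Or.inl hV0
  right
  refine le_antisymm hVle ?_
  have hVs' : bSpan V (L 0) ≤ V := by rw [bSpan_comm]; exact hVs
  -- every submodule of degree zero acting on `V` stays in `V`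
  have hV0mod : ∀ {P : Submodule F A}, P ≤ L 0 → bSpan V P ≤ V := fun hP =>
    (bSpan_mono le_rfl hP).trans hVs'
  have hVL1 := hV V hVle hV0 hVs
  set N := bSpan V (L q) with hN
  have hNle : N ≤ L (q - 2) := gr hVle le_rfl (by ring)
  -- `[N, L_{-q}] ⊆ V`
  have hNq : bSpan N (L (-q)) ≤ V := by
    refine bSpan_jacobi (hV0mod (gr le_rfl le_rfl (by ring))) ?_
    rw [grbot hVle le_rfl (by omega), bSpan_bot]
    exact bot_le
  -- `L_{-1} = [Z, N]`
  have hZN : L (-1) ≤ bSpan (L (-q + 1)) N := by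
    rw [← hVL1, bSpan_comm, ← hq1]
    refine bSpan_jacobi ?_ ?_
    · rw [bSpan_comm (L q) V]
    · rw [grbot le_rfl hVle (by omega), bSpan_bot]
      exact bot_le
  -- `L_{-2} = [L_{-1}, L_{-1}]`
  have hL2 : L (-2) = bSpan (L (-1)) (L (-1)) := by
    have := hD 2 (by norm_num)
    rwa [show (-2 : ℤ) + 1 = -1 by norm_num] at this
  -- `L_{-q} = [V, X]`
  have hVX : L (-q) ≤ bSpan V (L (-q + 2)) := by
    rw [← h4, ← hVL1]
    refine bSpan_jacobi (bSpan_mono le_rfl (gr le_rfl le_rfl (by ring))) ?_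
    rw [grbot hVle le_rfl (by omega), bSpan_bot]
    exact bot_le
  -- `L_{-2} ⊆ [L_{-q}, L_{q-2}]`
  have hL2q : L (-2) ≤ bSpan (L (-q)) (L (q - 2)) := by
    rw [hL2]
    refine (bSpan_mono (le_of_eq h5.symm) le_rfl).trans ?_
    refine bSpan_jacobi (bSpan_mono le_rfl (gr le_rfl le_rfl (by ring))) ?_
    rw [grbot le_rfl le_rfl (by omega), bSpan_bot]
    exact bot_le
  -- properties of the powers of `V`
  have hpdeg : ∀ k : ℕ, vpow V k ≤ L (-2 * (k + 1 : ℤ)) := by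
    intro k
    induction k with
    | zero => simpa [vpow] using hVle
    | succ k ih => exact gr hVle ih (by push_cast; ring)
  have hpmod : ∀ k : ℕ, bSpan (L 0) (vpow V k) ≤ vpow V k := by
    intro k
    induction k with
    | zero => exact hVs
    | succ k ih =>
      rw [bSpan_comm]
      refine bSpan_jacobi (bSpan_mono le_rfl ?_) ?_
      · rw [bSpan_comm]; exact ih
      · rw [bSpan_comm]; exact bSpan_mono hVs' le_rfl
  have hpV : ∀ k : ℕ, bSpan (vpow V k) (L (2 * (k : ℤ))) ≤ V := by
    intro k
    induction k with
    | zero => simpa [vpow] using hVs'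
    | succ k ih =>
      refine bSpan_jacobi (hV0mod (gr (hpdeg k) le_rfl (by push_cast; ring))) ?_
      exact (bSpan_mono le_rfl (gr hVle le_rfl (by push_cast; ring))).trans ih
  have hpne : ∀ k : ℕ, 2 * (k + 1 : ℤ) < q → vpow V k ≠ ⊥ := by
    intro k
    induction k with
    | zero => intro _; exact hV0
    | succ k ih =>
      intro hk hbot'
      push_cast at hk
      have hP := ih (by omega)
      -- `[N, V^k] = 0`
      have hNP : bSpan N (vpow V k) = ⊥ := by
        rw [eq_bot_iff]
        intro x hx
        by_contra hx0
        have hxd : x ∈ L (q - 2 - 2 * (k + 1 : ℤ)) := gr hNle (hpdeg k) (by ring) hx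
        obtain ⟨y, hy, hxy⟩ := hann _ (by omega) x hxd (by simpa using hx0)
        have hle : bSpan (bSpan N (vpow V k)) (L (-q)) ≤ ⊥ := by
          refine bSpan_jacobi ?_ ?_
          · rw [grbot (hpdeg k) le_rfl (by omega), bSpan_bot]
          · refine (bSpan_mono le_rfl hNq).trans ?_
            rw [bSpan_comm]
            exact le_of_eq hbot'
        exact hxy (by simpa using hle (mem_bSpan hx hy))
      obtain ⟨x, hx, hx0⟩ := Submodule.exists_mem_ne_zero_of_ne_bot hP
      obtain ⟨y, hy, hyx⟩ := hF1 _ (by omega) x (hpdeg k hx) hx0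
      have hle : bSpan (bSpan (L (-q + 1)) N) (vpow V k) ≤ ⊥ := by
        refine bSpan_jacobi ?_ ?_
        · rw [hNP, bSpan_bot]
        · rw [grbot le_rfl (hpdeg k) (by omega), bSpan_bot]
      exact hyx (by simpa using hle (mem_bSpan (hZN hy) hx))
  rcases Int.even_or_odd' q with ⟨m, hm | hm⟩
  · -- `q` even
    obtain ⟨k, hk⟩ := Int.eq_ofNat_of_zero_le (show 0 ≤ m - 2 by omega)
    have hX : vpow V k = L (-q + 2) := by
      refine (hi2.2 _ ?_ (hpmod k)).resolve_left (hpne k (by omega))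
      have := hpdeg k
      rwa [show -2 * ((k : ℤ) + 1) = -q + 2 by omega] at this
    refine hL2q.trans ((bSpan_mono hVX le_rfl).trans ?_)
    have := hpV (k + 1)
    rw [vpow, hX, show (2 * ((k + 1 : ℕ) : ℤ)) = q - 2 by push_cast; omega] at this
    exact this
  · -- `q` odd
    obtain ⟨k, hk⟩ := Int.eq_ofNat_of_zero_le (show 0 ≤ m - 1 by omega)
    have hZ : vpow V k = L (-q + 1) := by
      refine (hi1.2 _ ?_ (hpmod k)).resolve_left (hpne k (by omega))
      have := hpdeg k
      rwa [show -2 * ((k : ℤ) + 1) = -q + 1 by omega] at this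
    rw [hL2]
    refine (bSpan_mono hZN le_rfl).trans (bSpan_jacobi ?_ ?_)
    · have := hpV k
      rw [hZ, show (2 * (k : ℤ)) = q - 3 by omega] at this
      exact (bSpan_mono le_rfl (gr hNle le_rfl (by ring))).trans this
    · exact (bSpan_mono le_rfl (gr le_rfl le_rfl (by ring))).trans hNq

end GradedLie
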